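/- (Lemma 2.2) Suppose a(t) ≠ 0 for all t ≥ t0, and let t0 ≤ t1 < t2 < ∞. Let y be a solution of Eq. (1.1) on [t1, t2) such that the function F(t) := ∫_{t1}^{t} a(τ) y(τ) dτ is bounded from below on [t1, t2). Then [t1, t2) is not a maximal existence interval for y: there exist t3 > t2 and a solution ỹ of Eq. (1.1) on [t1, t3) with ỹ(t) = y(t) for all t ∈ [t1, t2). -/

import Mathlib

open Set

/-- ν(t,u,v,u₁,v₁) := u₁ − v₁ + (3/2) a(t)(u² − v²) + b(t)(u − v). -/
noncomputable def nuF (a b : ℝ → ℝ) (t u v u1 v1 : ℝ) : ℝ :=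
  u1 - v1 + (3/2) * a t * (u^2 - v^2) + b t * (u - v)

/-- Γ(t,u,v) := a(t)²(u² + uv + v²) + (c(t) − (3/2)a'(t))(u + v) − b'(t) + d(t). -/
noncomputable def GammaF (a b c d : ℝ → ℝ) (t u v : ℝ) : ℝ :=
  (a t)^2 * (u^2 + u*v + v^2) + (c t - (3/2) * deriv a t) * (u + v) - deriv b t + d t

/-- J(t,u,v) := (u − v) Γ(t,u,v). -/
noncomputable def JF (a b c d : ℝ → ℝ) (t u v : ℝ) : ℝ := (u - v) * GammaF a b c d t u v

/-- L(t,u,v), the comparison defect between Eq. (2.1)-type and Eq. (1.1)-type coefficients. -/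
noncomputable def LF (a b c d e a1 b1 c1 d1 e1 : ℝ → ℝ) (t u v : ℝ) : ℝ :=
  3*(a1 t - a t)*u*v + (b1 t - b t)*v + ((a1 t)^2 - (a t)^2)*u^3 +
  (c1 t - c t)*u^2 + (d1 t - d t)*u + (e1 t - e t)

/-- D(t) := 12 a(t)²(d(t) − b'(t)) − (2c(t) − 3a'(t))². -/
noncomputable def DF (a b c d : ℝ → ℝ) (t : ℝ) : ℝ :=
  12*(a t)^2*(d t - deriv b t) - (2*c t - 3*deriv a t)^2

/-- A solution of the second order Riccati equation
`y'' + 3a y y' + b y' + a² y³ + c y² + d y + e = 0` on a set `I`. -/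
def IsSolRiccati (a b c d e : ℝ → ℝ) (I : Set ℝ) (y : ℝ → ℝ) : Prop :=
  (∀ t ∈ I, DifferentiableAt ℝ y t) ∧ (∀ t ∈ I, DifferentiableAt ℝ (deriv y) t) ∧
  (∀ t ∈ I, deriv (deriv y) t + 3 * a t * y t * deriv y t + b t * deriv y t +
    (a t)^2 * (y t)^3 + c t * (y t)^2 + d t * y t + e t = 0)

/-- A solution of the differential inequality (2.11)
`η'' + 3a η η' + b η' + a² η³ + c η² + d η + e ≥ 0` on a set `I`. -/
def IsSupSolRiccati (a b c d e : ℝ → ℝ) (I : Set ℝ) (η : ℝ → ℝ) : Prop :=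
  (∀ t ∈ I, DifferentiableAt ℝ η t) ∧ (∀ t ∈ I, DifferentiableAt ℝ (deriv η) t) ∧
  (∀ t ∈ I, deriv (deriv η) t + 3 * a t * η t * deriv η t + b t * deriv η t +
    (a t)^2 * (η t)^3 + c t * (η t)^2 + d t * η t + e t ≥ 0)

/-- A solution of the differential inequality (2.16)
`ζ'' + 3a ζ ζ' + b ζ' + a² ζ³ + c ζ² + d ζ + e ≤ 0` on a set `I`. -/
def IsSubSolRiccati (a b c d e : ℝ → ℝ) (I : Set ℝ) (ζ : ℝ → ℝ) : Prop :=
  (∀ t ∈ I, DifferentiableAt ℝ ζ t) ∧ (∀ t ∈ I, DifferentiableAt ℝ (deriv ζ) t) ∧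
  (∀ t ∈ I, deriv (deriv ζ) t + 3 * a t * ζ t * deriv ζ t + b t * deriv ζ t +
    (a t)^2 * (ζ t)^3 + c t * (ζ t)^2 + d t * ζ t + e t ≤ 0)

open Filter Topology Metric NNReal in
/-- A bounded solution of a locally Lipschitz equation extends past a finite endpoint. -/
theorem exists_extension_of_bounded {E : Type*} [NormedAddCommGroup E] [NormedSpace ℝ E]
    [CompleteSpace E] {f : ℝ → E → E} {z : ℝ → E} {s t T R : ℝ} (hst : s < t) (htT : t < T)
    (hcont : ∀ x, ContinuousOn (f · x) (Icc s T))
    (hlip : ∀ R : ℝ, ∃ K : ℝ≥0, ∀ τ ∈ Icc s T, LipschitzOnWith K (f τ) (closedBall 0 R))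
    (hz : ∀ τ ∈ Ico s t, HasDerivAt z (f τ (z τ)) τ) (hR : ∀ τ ∈ Ico s t, ‖z τ‖ ≤ R) :
    ∃ t' > t, ∃ Z : ℝ → E, (∀ τ < t, Z τ = z τ) ∧
      ∀ τ ∈ Ico s t', HasDerivAt Z (f τ (Z τ)) τ := by
  have hbound : ∀ R : ℝ, ∃ L : ℝ≥0, ∀ τ ∈ Icc s T, ∀ x ∈ closedBall (0 : E) R, ‖f τ x‖ ≤ L := by
    intro R
    obtain ⟨K, hK⟩ := hlip R
    obtain ⟨C, hC⟩ := isCompact_Icc.exists_bound_of_continuousOn (hcont 0)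
    refine ⟨Real.toNNReal (C + K * R), fun τ hτ x hx ↦ ?_⟩
    have hxR : ‖x‖ ≤ R := by simpa using hx
    have h0 : (0 : E) ∈ closedBall (0 : E) R := by simpa using (norm_nonneg x).trans hxR
    have h1 := (hK τ hτ).norm_sub_le hx h0
    have h2 := norm_sub_norm_le (f τ x) (f τ 0)
    have h3 := hC τ hτ
    have h4 : (K : ℝ) * ‖x - 0‖ ≤ K * R := by rw [sub_zero]; gcongr
    exact (by linarith : ‖f τ x‖ ≤ C + K * R).trans (Real.le_coe_toNNReal _)
  have hsub : Ico s t ⊆ Icc s T := fun τ hτ ↦ ⟨hτ.1, (hτ.2.trans htT).le⟩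
  obtain ⟨L, hL⟩ := hbound R
  have hzlip : LipschitzOnWith L z (Ico s t) :=
    (convex_Ico s t).lipschitzOnWith_of_nnnorm_hasDerivWithin_le
      (fun τ hτ ↦ (hz τ hτ).hasDerivWithinAt)
      (fun τ hτ ↦ hL τ (hsub hτ) _ (by simpa using hR τ hτ))
  have hIco : Ico s t ∈ 𝓝[<] t := Ico_mem_nhdsLT hst
  obtain ⟨z₀, hz₀⟩ : ∃ z₀, Tendsto z (𝓝[<] t) (𝓝 z₀) :=
    CompleteSpace.complete ((cauchy_nhds.mono nhdsWithin_le_nhds).map_of_le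
      hzlip.uniformContinuousOn (le_principal_iff.2 hIco))
  have hz₀R : ‖z₀‖ ≤ R :=
    le_of_tendsto hz₀.norm (by filter_upwards [hIco] with τ hτ using hR τ hτ)
  obtain ⟨K, hK⟩ := hlip (‖z₀‖ + 1)
  obtain ⟨M, hM⟩ := hbound (‖z₀‖ + 1)
  have hball : closedBall z₀ 1 ⊆ closedBall 0 (‖z₀‖ + 1) := by
    intro x hx
    have := norm_sub_norm_le x z₀
    simp only [mem_closedBall, dist_eq_norm, sub_zero] at hx ⊢
    linarith
  set δ : ℝ := min (min (t - s) (T - t)) (1 / (M + 1)) with hδ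
  have hM1 : (0 : ℝ) < M + 1 := by positivity
  have hδ0 : 0 < δ := by
    simp only [hδ, lt_min_iff]
    exact ⟨⟨by linarith, by linarith⟩, by positivity⟩
  have hδs : δ ≤ t - s := (min_le_left _ _).trans (min_le_left _ _)
  have hδT : δ ≤ T - t := (min_le_left _ _).trans (min_le_right _ _)
  have hδM : M * δ ≤ 1 := by
    have : δ ≤ 1 / (M + 1) := min_le_right _ _
    rw [le_div_iff₀ hM1] at this
    linarith
  have hI : Icc (t - δ) (t + δ) ⊆ Icc s T := Icc_subset_Icc (by linarith) (by linarith)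
  have hPL : IsPicardLindelof f (tmin := t - δ) (tmax := t + δ)
      ⟨t, by constructor <;> linarith⟩ z₀ 1 0 M K :=
    { lipschitzOnWith := fun τ hτ ↦ (hK τ (hI hτ)).mono (by simpa using hball)
      continuousOn := fun x _ ↦ (hcont x).mono hI
      norm_le := fun τ hτ x hx ↦ hM τ (hI hτ) x (hball (by simpa using hx))
      mul_max_le := by simpa using hδM }
  obtain ⟨α, hα0, hα⟩ := hPL.exists_eq_forall_mem_Icc_hasDerivWithinAt₀
  simp only at hα0
  have hαd : ∀ τ ∈ Ioo (t - δ) (t + δ), HasDerivAt α (f τ (α τ)) τ := fun τ hτ ↦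
    (hα τ (Ioo_subset_Icc_self hτ)).hasDerivAt (Icc_mem_nhds hτ.1 hτ.2)
  let Z : ℝ → E := fun τ ↦ if τ < t then z τ else α τ
  have hZl : ∀ τ < t, Z τ = z τ := fun τ hτ ↦ if_pos hτ
  have hZr : ∀ τ, t ≤ τ → Z τ = α τ := fun τ hτ ↦ if_neg hτ.not_gt
  have hZt : Z t = z₀ := (hZr t le_rfl).trans hα0
  have hZd : ∀ τ ∈ Ico s t, HasDerivAt Z (f τ (Z τ)) τ := by
    intro τ hτ
    rw [hZl τ hτ.2]
    refine (hz τ hτ).congr_of_eventuallyEq ?_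
    filter_upwards [Iio_mem_nhds hτ.2] with σ hσ using hZl σ hσ
  refine ⟨t + δ, by linarith, Z, hZl, fun τ hτ ↦ ?_⟩
  rcases lt_trichotomy τ t with h | h | h
  · exact hZd τ ⟨hτ.1, h⟩
  · subst h
    rw [hZt]
    have hright : HasDerivWithinAt Z (f τ z₀) (Ici τ) τ := by
      have h1 := (hαd τ (by constructor <;> linarith)).hasDerivWithinAt (s := Ici τ)
      rw [hα0] at h1
      exact h1.congr (fun σ hσ ↦ hZr σ hσ) (hZr τ le_rfl)
    have hlimZ : Tendsto Z (𝓝[<] τ) (𝓝 z₀) :=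
      hz₀.congr' (by filter_upwards [self_mem_nhdsWithin] with σ hσ using (hZl σ hσ).symm)
    have hleft : HasDerivWithinAt Z (f τ z₀) (Iic τ) τ := by
      refine hasDerivWithinAt_Iic_of_tendsto_deriv (s := Ico s τ)
        (fun σ hσ ↦ (hZd σ hσ).differentiableAt.differentiableWithinAt) ?_ hIco ?_
      · rw [ContinuousWithinAt, hZt]
        exact hlimZ.mono_left (nhdsWithin_mono _ fun σ hσ ↦ hσ.2)
      · obtain ⟨K', hK'⟩ := hlip (R + 1)
        have hjoint : ContinuousOn (fun p : ℝ × E ↦ f p.1 p.2)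
            (Icc s T ×ˢ closedBall (0 : E) (R + 1)) :=
          continuousOn_prod_of_continuousOn_lipschitzOnWith' _ K' hK' (fun x _ ↦ hcont x)
        have hmem : (τ, z₀) ∈ Icc s T ×ˢ closedBall (0 : E) (R + 1) :=
          ⟨⟨hτ.1, htT.le⟩, by simpa using hz₀R.trans (by linarith)⟩
        have hpair : Tendsto (fun σ ↦ (σ, z σ)) (𝓝[<] τ)
            (𝓝[Icc s T ×ˢ closedBall (0 : E) (R + 1)] (τ, z₀)) := by
          refine tendsto_nhdsWithin_iff.2 ⟨?_, ?_⟩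
          · exact (tendsto_id.mono_left nhdsWithin_le_nhds).prodMk_nhds hz₀
          · filter_upwards [hIco] with σ hσ
            exact ⟨hsub hσ, by simpa using (hR σ hσ).trans (by linarith)⟩
        refine ((hjoint _ hmem).tendsto.comp hpair).congr' ?_
        filter_upwards [hIco] with σ hσ
        rw [(hZd σ hσ).deriv, hZl σ hσ.2]
        rfl
    have := hleft.union hright
    rwa [Iic_union_Ici, hasDerivWithinAt_univ] at this
  · rw [hZr τ h.le]
    refine (hαd τ ⟨by linarith, hτ.2⟩).congr_of_eventuallyEq ?_
    filter_upwards [Ioi_mem_nhds h] with σ hσ using hZr σ (le_of_lt hσ)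

theorem le_of_hasDerivAt_nonneg {f f' : ℝ → ℝ} {s t : ℝ}
    (hf : ∀ τ ∈ Ico s t, HasDerivAt f (f' τ) τ) (hf' : ∀ τ ∈ Ico s t, 0 ≤ f' τ) :
    ∀ τ ∈ Ico s t, f s ≤ f τ := by
  have hmono : MonotoneOn f (Ico s t) := by
    refine monotoneOn_of_deriv_nonneg (convex_Ico s t)
      (fun τ hτ ↦ (hf τ hτ).continuousAt.continuousWithinAt) (fun τ hτ ↦ ?_) (fun τ hτ ↦ ?_)
    · exact (hf τ (interior_subset hτ)).differentiableAt.differentiableWithinAt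
    · rw [(hf τ (interior_subset hτ)).deriv]
      exact hf' τ (interior_subset hτ)
  exact fun τ hτ ↦ hmono ⟨le_rfl, hτ.1.trans_lt hτ.2⟩ hτ hτ.1

theorem abs_le_of_abs_hasDerivAt_le {f f' g g' : ℝ → ℝ} {s t : ℝ}
    (hf : ∀ τ ∈ Ico s t, HasDerivAt f (f' τ) τ) (hg : ∀ τ ∈ Ico s t, HasDerivAt g (g' τ) τ)
    (hfg : ∀ τ ∈ Ico s t, |f' τ| ≤ g' τ) :
    ∀ τ ∈ Ico s t, |f τ| ≤ |f s| + (g τ - g s) := by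
  intro τ hτ
  have h1 := le_of_hasDerivAt_nonneg (fun σ hσ ↦ (hg σ hσ).sub (hf σ hσ))
    (fun σ hσ ↦ sub_nonneg.2 ((le_abs_self _).trans (hfg σ hσ))) τ hτ
  have h2 := le_of_hasDerivAt_nonneg (fun σ hσ ↦ (hg σ hσ).add (hf σ hσ))
    (fun σ hσ ↦ by linarith [neg_abs_le (f' σ), hfg σ hσ]) τ hτ
  simp only [Pi.sub_apply, Pi.add_apply] at h1 h2
  rw [abs_le]
  constructor <;> linarith [le_abs_self (f s), neg_abs_le (f s)]

theorem hasDerivAt_integral_of_continuousOn_Ico {g : ℝ → ℝ} {s t : ℝ}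
    (hg : ContinuousOn g (Ico s t)) :
    ∃ G : ℝ → ℝ, (∀ τ ∈ Ico s t, G τ = ∫ x in s..τ, g x) ∧
      ∀ τ ∈ Ico s t, HasDerivAt G (g τ) τ := by
  have hc : ContinuousOn (fun x ↦ g (max s x)) (Iio t) := by
    intro x hx
    by_cases hst : s < t
    · exact (hg.comp (continuous_const.max continuous_id).continuousOn
        (fun y hy ↦ ⟨le_max_left _ _, max_lt hst hy⟩)) x hx
    · have hev : (fun y ↦ g (max s y)) =ᶠ[nhds x] fun _ ↦ g s := by
        filter_upwards [Iio_mem_nhds hx] with y hy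
        rw [max_eq_left (hy.le.trans (not_lt.1 hst))]
      exact (continuousAt_const.congr hev.symm).continuousWithinAt
  refine ⟨fun τ ↦ ∫ x in s..τ, g (max s x), fun τ hτ ↦ ?_, fun τ hτ ↦ ?_⟩
  · refine intervalIntegral.integral_congr fun x hx ↦ ?_
    rw [uIcc_of_le hτ.1] at hx
    simp only [max_eq_right hx.1]
  · have hd := intervalIntegral.integral_hasDerivAt_right (a := s) (b := τ)
      (f := fun x ↦ g (max s x))
      ((hc.mono (by
        rw [uIcc_of_le hτ.1]
        exact fun x hx ↦ hx.2.trans_lt hτ.2)).intervalIntegrable)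
      (hc.stronglyMeasurableAtFilter isOpen_Iio τ hτ.2)
      (hc.continuousAt (Iio_mem_nhds hτ.2))
    simpa only [max_eq_right hτ.1] using hd

/-- Solutions of the system `u' = a v`, `v' = w`, `w' = h` with `u` bounded away from zero stay
bounded when `h` grows at most linearly, up to a term `v² / u`. Integrating `v² / u` by parts
costs only a logarithm, and a Gronwall argument for the logarithm of the norm applies. -/
theorem exists_bound_of_quadratic_over_linear {u v w h a r r' : ℝ → ℝ} {s t δ K : ℝ}
    (hst : s < t) (hδ : 0 < δ) (hK : 1 ≤ K)
    (hu : ∀ τ ∈ Ico s t, HasDerivAt u (a τ * v τ) τ)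
    (hv : ∀ τ ∈ Ico s t, HasDerivAt v (w τ) τ)
    (hw : ∀ τ ∈ Ico s t, HasDerivAt w (h τ) τ)
    (hr : ∀ τ ∈ Ico s t, HasDerivAt r (r' τ) τ)
    (hra : ∀ τ ∈ Ico s t, r τ * a τ = 1)
    (haK : ∀ τ ∈ Ico s t, |a τ| ≤ K) (hrK : ∀ τ ∈ Ico s t, |r τ| ≤ K)
    (hrK' : ∀ τ ∈ Ico s t, |r' τ| ≤ K) (hδu : ∀ τ ∈ Ico s t, δ ≤ u τ)
    (hh : ∀ τ ∈ Ico s t, |h τ| ≤ K * (|u τ| + |v τ| + |w τ| + v τ ^ 2 / u τ)) :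
    ∃ B, ∀ τ ∈ Ico s t, |u τ| + |v τ| + |w τ| ≤ B := by
  set N : ℝ → ℝ := fun τ ↦ |u τ| + |v τ| + |w τ| with hN
  have hN0 : ∀ τ, 0 ≤ N τ := fun τ ↦ by positivity
  have hNc : ContinuousOn N (Ico s t) := by
    have hcu : ContinuousOn u (Ico s t) := fun τ hτ ↦ (hu τ hτ).continuousAt.continuousWithinAt
    have hcv : ContinuousOn v (Ico s t) := fun τ hτ ↦ (hv τ hτ).continuousAt.continuousWithinAt
    have hcw : ContinuousOn w (Ico s t) := fun τ hτ ↦ (hw τ hτ).continuousAt.continuousWithinAt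
    exact (hcu.abs.add hcv.abs).add hcw.abs
  have hs : s ∈ Ico s t := ⟨le_rfl, hst⟩
  have hu0 : ∀ τ ∈ Ico s t, 0 < u τ := fun τ hτ ↦ hδ.trans_le (hδu τ hτ)
  obtain ⟨P, -, hP⟩ := hasDerivAt_integral_of_continuousOn_Ico hNc
  set W : ℝ → ℝ := fun τ ↦ 1 + N s + (P τ - P s) with hWdef
  have hW : ∀ τ ∈ Ico s t, HasDerivAt W (N τ) τ := fun τ hτ ↦
    ((hP τ hτ).sub_const _).const_add _
  have hWs : W s = 1 + N s := by simp [hWdef]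
  have hWmono := le_of_hasDerivAt_nonneg hW (fun τ _ ↦ hN0 τ)
  have hW1 : ∀ τ ∈ Ico s t, 1 ≤ W τ := fun τ hτ ↦ by
    have := hWmono τ hτ
    linarith [hN0 s]
  have hKW : ∀ τ ∈ Ico s t, HasDerivAt (fun τ ↦ K * W τ) (K * N τ) τ := fun τ hτ ↦
    (hW τ hτ).const_mul K
  have huN : ∀ τ, |u τ| ≤ N τ := fun τ ↦ by
    simp only [hN]; linarith [abs_nonneg (v τ), abs_nonneg (w τ)]
  have hvN : ∀ τ, |v τ| ≤ N τ := fun τ ↦ by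
    simp only [hN]; linarith [abs_nonneg (u τ), abs_nonneg (w τ)]
  have hwN : ∀ τ, |w τ| ≤ N τ := fun τ ↦ by
    simp only [hN]; linarith [abs_nonneg (v τ), abs_nonneg (u τ)]
  have hNsKW : N s ≤ K * W s := by rw [hWs]; nlinarith [hN0 s]
  have huW : ∀ τ ∈ Ico s t, |u τ| ≤ K * W τ := fun τ hτ ↦ by
    have := abs_le_of_abs_hasDerivAt_le hu hKW (fun σ hσ ↦ by
      rw [abs_mul]
      exact mul_le_mul (haK σ hσ) (hvN σ) (abs_nonneg _) (by linarith)) τ hτ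
    linarith [huN s]
  have hvW : ∀ τ ∈ Ico s t, |v τ| ≤ K * W τ := fun τ hτ ↦ by
    have := abs_le_of_abs_hasDerivAt_le hv hKW (fun σ hσ ↦ by
      nlinarith [hwN σ, hN0 σ]) τ hτ
    linarith [hvN s]
  set L : ℝ := 1 + |Real.log δ| + Real.log K with hL
  have hL1 : 1 ≤ L := by linarith [abs_nonneg (Real.log δ), Real.log_nonneg hK]
  set ℓ : ℝ → ℝ := fun τ ↦ L + Real.log (W τ) with hℓdef
  have hℓ : ∀ τ ∈ Ico s t, HasDerivAt ℓ (N τ / W τ) τ := fun τ hτ ↦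
    ((hW τ hτ).log (by linarith [hW1 τ hτ])).const_add _
  have hℓ1 : ∀ τ ∈ Ico s t, 1 ≤ ℓ τ := fun τ hτ ↦ by
    have := Real.log_nonneg (hW1 τ hτ)
    simp only [hℓdef]; linarith
  have hlog : ∀ τ ∈ Ico s t, |Real.log (u τ)| ≤ ℓ τ := fun τ hτ ↦ by
    have h1 := Real.log_le_log hδ (hδu τ hτ)
    have h2 := Real.log_le_log (hu0 τ hτ) ((le_abs_self _).trans (huW τ hτ))
    rw [Real.log_mul (by linarith) (by linarith [hW1 τ hτ])] at h2
    have h3 := Real.log_nonneg (hW1 τ hτ)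
    have h4 := Real.log_nonneg hK
    simp only [hℓdef, abs_le]
    constructor <;> linarith [neg_abs_le (Real.log δ), abs_nonneg (Real.log δ)]
  set A : ℝ → ℝ := fun τ ↦
    K * W τ + (K ^ 2 * (W τ * ℓ τ) + K * (v τ * r τ * Real.log (u τ))) with hA
  have hAd : ∀ τ ∈ Ico s t, HasDerivAt A (K * N τ + (K ^ 2 * (N τ * ℓ τ + W τ * (N τ / W τ)) +
      K * ((w τ * r τ + v τ * r' τ) * Real.log (u τ) +
        v τ * r τ * (a τ * v τ / u τ)))) τ := fun τ hτ ↦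
    (hKW τ hτ).add ((((hW τ hτ).mul (hℓ τ hτ)).const_mul _).add
      ((((hv τ hτ).mul (hr τ hτ)).mul ((hu τ hτ).log (hu0 τ hτ).ne')).const_mul _))
  have hwA := abs_le_of_abs_hasDerivAt_le hw hAd (fun τ hτ ↦ by
    refine (hh τ hτ).trans ?_
    have hWN : W τ * (N τ / W τ) = N τ := mul_div_cancel₀ _ (by linarith [hW1 τ hτ])
    have hva : v τ * r τ * (a τ * v τ / u τ) = v τ ^ 2 / u τ := by
      linear_combination (v τ ^ 2 / u τ) * hra τ hτ
    have h1 : |(w τ * r τ + v τ * r' τ) * Real.log (u τ)| ≤ K * N τ * ℓ τ := by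
      rw [abs_mul]
      refine mul_le_mul ?_ (hlog τ hτ) (abs_nonneg _) (by have := hN0 τ; positivity)
      refine (abs_add_le _ _).trans ?_
      rw [abs_mul, abs_mul]
      have e1 := mul_le_mul_of_nonneg_left (hrK τ hτ) (abs_nonneg (w τ))
      have e2 := mul_le_mul_of_nonneg_left (hrK' τ hτ) (abs_nonneg (v τ))
      have e3 := mul_nonneg (by linarith : (0 : ℝ) ≤ K) (abs_nonneg (u τ))
      simp only [hN]
      linarith
    have h2 := mul_le_mul_of_nonneg_left (neg_abs_le ((w τ * r τ + v τ * r' τ) * Real.log (u τ)))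
      (by linarith : (0 : ℝ) ≤ K)
    have h3 := mul_le_mul_of_nonneg_left h1 (by linarith : (0 : ℝ) ≤ K)
    have h4 := mul_nonneg (sq_nonneg K) (hN0 τ)
    rw [hWN, hva]
    change K * (N τ + v τ ^ 2 / u τ) ≤ _
    linarith)
  set D : ℝ := 2 * K + (1 + |A s| + K + K ^ 2 + K ^ 3) with hD
  have hD0 : 0 ≤ D := by positivity
  have hND : ∀ τ ∈ Ico s t, N τ ≤ D * (W τ * ℓ τ) := fun τ hτ ↦ by
    have hK0 : 0 ≤ K := by linarith
    have hW0 : 0 ≤ W τ := by linarith [hW1 τ hτ]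
    have hWℓ : W τ ≤ W τ * ℓ τ := le_mul_of_one_le_right hW0 (hℓ1 τ hτ)
    have hWℓ1 : 1 ≤ W τ * ℓ τ := (hW1 τ hτ).trans hWℓ
    have h1 : |v τ * r τ * Real.log (u τ)| ≤ K * W τ * K * ℓ τ := by
      rw [abs_mul, abs_mul]
      have := hvW τ hτ
      have := hrK τ hτ
      have := hlog τ hτ
      gcongr
    have h2 := mul_le_mul_of_nonneg_left ((le_abs_self _).trans h1) hK0
    have h3 := hwA τ hτ
    have h4 : |w s| ≤ W τ := by linarith [hwN s, hWmono τ hτ]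
    have h5 : |A s| ≤ |A s| * (W τ * ℓ τ) := le_mul_of_one_le_right (abs_nonneg _) hWℓ1
    have h6 := mul_le_mul_of_nonneg_left hWℓ hK0
    have h7 : A τ = K * W τ + (K ^ 2 * (W τ * ℓ τ) + K * (v τ * r τ * Real.log (u τ))) := rfl
    have h8 := huW τ hτ
    have h9 := hvW τ hτ
    have h10 : N τ = |u τ| + |v τ| + |w τ| := rfl
    rw [hD, h10]
    linarith [neg_abs_le (A s)]
  have hgd : ∀ τ ∈ Ico s t, HasDerivAt (fun τ ↦ -(ℓ τ * Real.exp (-(D * τ))))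
      (-(N τ / W τ * Real.exp (-(D * τ)) + ℓ τ * (Real.exp (-(D * τ)) * -(D * 1)))) τ :=
    fun τ hτ ↦ ((hℓ τ hτ).mul (((hasDerivAt_id τ).const_mul D).neg.exp)).neg
  have hg := le_of_hasDerivAt_nonneg hgd (fun τ hτ ↦ by
    have h1 : N τ / W τ ≤ D * ℓ τ := by
      rw [div_le_iff₀ (by linarith [hW1 τ hτ])]
      linarith [hND τ hτ]
    nlinarith [Real.exp_pos (-(D * τ))])
  set Q : ℝ := ℓ s * Real.exp (D * (t - s)) with hQ
  have hℓQ : ∀ τ ∈ Ico s t, ℓ τ ≤ Q := fun τ hτ ↦ by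
    have h1 := neg_le_neg_iff.1 (hg τ hτ)
    have h2 : ℓ τ = ℓ τ * Real.exp (-(D * τ)) * Real.exp (D * τ) := by
      rw [mul_assoc, ← Real.exp_add]; simp
    have h3 : ℓ s * Real.exp (-(D * s)) * Real.exp (D * τ) = ℓ s * Real.exp (D * (τ - s)) := by
      rw [mul_assoc, ← Real.exp_add]; ring_nf
    have h4 : Real.exp (D * (τ - s)) ≤ Real.exp (D * (t - s)) :=
      Real.exp_le_exp.2 (mul_le_mul_of_nonneg_left (by linarith [hτ.2]) hD0)
    calc ℓ τ = ℓ τ * Real.exp (-(D * τ)) * Real.exp (D * τ) := h2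
      _ ≤ ℓ s * Real.exp (-(D * s)) * Real.exp (D * τ) := by gcongr
      _ = ℓ s * Real.exp (D * (τ - s)) := h3
      _ ≤ Q := mul_le_mul_of_nonneg_left h4 (by linarith [hℓ1 s hs])
  refine ⟨D * (Real.exp Q * Q), fun τ hτ ↦ (hND τ hτ).trans ?_⟩
  have hWQ : W τ ≤ Real.exp Q := by
    rw [← Real.log_le_iff_le_exp (by linarith [hW1 τ hτ])]
    have := hℓQ τ hτ
    simp only [hℓdef] at this
    linarith
  exact mul_le_mul_of_nonneg_left
    (mul_le_mul hWQ (hℓQ τ hτ) (by linarith [hℓ1 τ hτ]) (Real.exp_pos _).le) hD0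

/-- The vector field of the first order system equivalent to Eq. (1.1). -/
def riccatiField (a b c d e : ℝ → ℝ) (t : ℝ) (z : ℝ × ℝ) : ℝ × ℝ :=
  (z.2, -(3 * a t * z.1 * z.2 + b t * z.2 + a t ^ 2 * z.1 ^ 3 + c t * z.1 ^ 2 + d t * z.1 + e t))

open NNReal Metric in
theorem riccatiField_lipschitzOnWith {a b c d e : ℝ → ℝ} {I : Set ℝ} {M : ℝ}
    (ha : ∀ t ∈ I, |a t| ≤ M) (hb : ∀ t ∈ I, |b t| ≤ M) (hc : ∀ t ∈ I, |c t| ≤ M)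
    (hd : ∀ t ∈ I, |d t| ≤ M) (R : ℝ) :
    ∃ K : ℝ≥0, ∀ t ∈ I, LipschitzOnWith K (riccatiField a b c d e t) (closedBall 0 R) := by
  refine ⟨Real.toNNReal (1 + (6 * M * R + M + 3 * M ^ 2 * R ^ 2 + 2 * M * R + M)), fun t ht ↦ ?_⟩
  refine LipschitzOnWith.of_dist_le_mul fun z hz z' hz' ↦ ?_
  refine le_trans ?_ (mul_le_mul_of_nonneg_right (Real.le_coe_toNNReal _) dist_nonneg)
  obtain ⟨x, p⟩ := z
  obtain ⟨x', p'⟩ := z'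
  simp only [mem_closedBall, dist_zero_right, Prod.norm_def, Real.norm_eq_abs, sup_le_iff]
    at hz hz'
  obtain ⟨hx, hp⟩ := hz
  obtain ⟨hx', hp'⟩ := hz'
  rw [dist_eq_norm, dist_eq_norm]
  set Δ := ‖((x, p) : ℝ × ℝ) - (x', p')‖ with hΔ
  have hΔx : |x - x'| ≤ Δ := norm_fst_le (((x, p) : ℝ × ℝ) - (x', p'))
  have hΔp : |p - p'| ≤ Δ := norm_snd_le (((x, p) : ℝ × ℝ) - (x', p'))
  have hΔ0 : 0 ≤ Δ := norm_nonneg _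
  have hM : 0 ≤ M := (abs_nonneg _).trans (ha t ht)
  have hR : 0 ≤ R := (abs_nonneg _).trans hx
  have hat := ha t ht
  have hbt := hb t ht
  have hct := hc t ht
  have hdt := hd t ht
  rw [Prod.norm_def, sup_le_iff]
  constructor
  · change |p - p'| ≤ _
    have : 0 ≤ (6 * M * R + M + 3 * M ^ 2 * R ^ 2 + 2 * M * R + M) * Δ := by positivity
    linarith
  · have hx2 : |x + x'| ≤ 2 * R := (abs_add_le _ _).trans (by linarith)
    have hx3 : |x ^ 2 + x * x' + x' ^ 2| ≤ 3 * R ^ 2 := by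
      have h1 : |x ^ 2| ≤ R ^ 2 := by rw [abs_pow]; gcongr
      have h2 : |x' ^ 2| ≤ R ^ 2 := by rw [abs_pow]; gcongr
      have h3 : |x * x'| ≤ R * R := by rw [abs_mul]; gcongr
      refine (abs_add_three _ _ _).trans ?_
      linarith
    have k1 : |a t * (x * (p - p'))| ≤ M * (R * Δ) := by rw [abs_mul, abs_mul]; gcongr
    have k2 : |a t * (p' * (x - x'))| ≤ M * (R * Δ) := by rw [abs_mul, abs_mul]; gcongr
    have k3 : |b t * (p - p')| ≤ M * Δ := by rw [abs_mul]; gcongr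
    have k4 : |a t ^ 2 * ((x ^ 2 + x * x' + x' ^ 2) * (x - x'))| ≤ M ^ 2 * (3 * R ^ 2 * Δ) := by
      rw [abs_mul, abs_mul, abs_pow]; gcongr
    have k5 : |c t * ((x + x') * (x - x'))| ≤ M * (2 * R * Δ) := by
      rw [abs_mul, abs_mul]; gcongr
    have k6 : |d t * (x - x')| ≤ M * Δ := by rw [abs_mul]; gcongr
    have hdiff : (riccatiField a b c d e t (x, p) - riccatiField a b c d e t (x', p')).2 =
        -(3 * (a t * (x * (p - p'))) + 3 * (a t * (p' * (x - x'))) + b t * (p - p') +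
          a t ^ 2 * ((x ^ 2 + x * x' + x' ^ 2) * (x - x')) + c t * ((x + x') * (x - x')) +
          d t * (x - x')) := by
      simp only [riccatiField, Prod.snd_sub]
      ring
    rw [hdiff, Real.norm_eq_abs]
    rw [abs_le] at k1 k2 k3 k4 k5 k6 ⊢
    constructor <;> linarith

theorem riccatiField_continuousOn {a b c d e : ℝ → ℝ} {I : Set ℝ} (ha : ContinuousOn a I)
    (hb : ContinuousOn b I) (hc : ContinuousOn c I) (hd : ContinuousOn d I)
    (he : ContinuousOn e I) (z : ℝ × ℝ) :
    ContinuousOn (fun t ↦ riccatiField a b c d e t z) I := by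
  unfold riccatiField
  fun_prop

theorem IsSolRiccati.hasDerivAt {a b c d e : ℝ → ℝ} {I : Set ℝ} {y : ℝ → ℝ}
    (hy : IsSolRiccati a b c d e I y) {t : ℝ} (ht : t ∈ I) :
    HasDerivAt (fun τ ↦ (y τ, deriv y τ)) (riccatiField a b c d e t (y t, deriv y t)) t := by
  have h2 : (riccatiField a b c d e t (y t, deriv y t)).2 = deriv (deriv y) t := by
    simp only [riccatiField]
    linear_combination -(hy.2.2 t ht)
  refine (hy.1 t ht).hasDerivAt.prodMk ?_
  exact (hy.2.1 t ht).hasDerivAt.congr_deriv h2.symm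

/-- A solution on `[t₁, t₂)` whose trajectory `(y, y')` is bounded extends beyond `t₂`. -/
theorem IsSolRiccati.exists_extension {a b c d e y : ℝ → ℝ} {t₁ t₂ T R : ℝ} (h12 : t₁ < t₂)
    (h2T : t₂ < T) (ha : ContinuousOn a (Icc t₁ T)) (hb : ContinuousOn b (Icc t₁ T))
    (hc : ContinuousOn c (Icc t₁ T)) (hd : ContinuousOn d (Icc t₁ T))
    (he : ContinuousOn e (Icc t₁ T)) (hy : IsSolRiccati a b c d e (Ico t₁ t₂) y)
    (hR : ∀ t ∈ Ico t₁ t₂, |y t| ≤ R ∧ |deriv y t| ≤ R) :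
    ∃ t₃ > t₂, ∃ Y : ℝ → ℝ, IsSolRiccati a b c d e (Ico t₁ t₃) Y ∧
      ∀ t ∈ Ico t₁ t₂, Y t = y t := by
  obtain ⟨Ca, hCa⟩ := isCompact_Icc.exists_bound_of_continuousOn ha
  obtain ⟨Cb, hCb⟩ := isCompact_Icc.exists_bound_of_continuousOn hb
  obtain ⟨Cc, hCc⟩ := isCompact_Icc.exists_bound_of_continuousOn hc
  obtain ⟨Cd, hCd⟩ := isCompact_Icc.exists_bound_of_continuousOn hd
  set M := max (max Ca Cb) (max Cc Cd)
  obtain ⟨t₃, h23, Z, hZy, hZ⟩ := exists_extension_of_bounded h12 h2T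
    (riccatiField_continuousOn ha hb hc hd he)
    (riccatiField_lipschitzOnWith (M := M)
      (fun t ht ↦ (hCa t ht).trans ((le_max_left _ _).trans (le_max_left _ _)))
      (fun t ht ↦ (hCb t ht).trans ((le_max_right _ _).trans (le_max_left _ _)))
      (fun t ht ↦ (hCc t ht).trans ((le_max_left _ _).trans (le_max_right _ _)))
      (fun t ht ↦ (hCd t ht).trans ((le_max_right _ _).trans (le_max_right _ _))))
    (fun t ht ↦ hy.hasDerivAt ht)
    (fun t ht ↦ by simpa [Prod.norm_def] using hR t ht)
  have hZ1 : ∀ t ∈ Ico t₁ t₃, HasDerivAt (fun τ ↦ (Z τ).1) (Z t).2 t := fun t ht ↦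
    (hasFDerivAt_fst (𝕜 := ℝ) (p := Z t)).comp_hasDerivAt t (hZ t ht)
  have hZ2 : ∀ t ∈ Ico t₁ t₃,
      HasDerivAt (fun τ ↦ (Z τ).2) (riccatiField a b c d e t (Z t)).2 t := fun t ht ↦
    (hasFDerivAt_snd (𝕜 := ℝ) (p := Z t)).comp_hasDerivAt t (hZ t ht)
  have hev : ∀ t ∈ Ico t₁ t₃, deriv (fun τ ↦ (Z τ).1) =ᶠ[nhds t] fun τ ↦ (Z τ).2 := by
    intro t ht
    by_cases h : t < t₂
    · filter_upwards [Iio_mem_nhds h] with σ hσ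
      have hloc : (fun τ ↦ (Z τ).1) =ᶠ[nhds σ] y := by
        filter_upwards [Iio_mem_nhds hσ] with ρ hρ
        rw [hZy ρ hρ]
      rw [hloc.deriv_eq, hZy σ hσ]
    · filter_upwards [Ioo_mem_nhds (h12.trans_le (not_lt.1 h)) ht.2] with σ hσ
      exact (hZ1 σ (Ioo_subset_Ico_self hσ)).deriv
  have hdd : ∀ t ∈ Ico t₁ t₃, HasDerivAt (deriv fun τ ↦ (Z τ).1)
      (riccatiField a b c d e t (Z t)).2 t := fun t ht ↦
    (hZ2 t ht).congr_of_eventuallyEq (hev t ht)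
  refine ⟨t₃, h23, fun τ ↦ (Z τ).1, ⟨fun t ht ↦ (hZ1 t ht).differentiableAt,
    fun t ht ↦ (hdd t ht).differentiableAt, fun t ht ↦ ?_⟩, fun t ht ↦ ?_⟩
  · rw [(hdd t ht).deriv, (hZ1 t ht).deriv]
    simp only [riccatiField]
    ring
  · simp only [hZy t ht.2]

/-- A lower bound on `∫ a y` forces the trajectory `(y, y')` to stay bounded. With
`u = exp (∫ a y)`, the functions `v = u y` and `w = v'` solve a system that is linear except for
a term `v² / u`. -/
theorem IsSolRiccati.exists_bound {a b c d e y : ℝ → ℝ} {t₁ t₂ m : ℝ} (h12 : t₁ < t₂)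
    (hbc : ContinuousOn b (Icc t₁ t₂)) (hcc : ContinuousOn c (Icc t₁ t₂))
    (hdc : ContinuousOn d (Icc t₁ t₂)) (hec : ContinuousOn e (Icc t₁ t₂))
    (had : ∀ t ∈ Icc t₁ t₂, DifferentiableAt ℝ a t) (ha' : ContinuousOn (deriv a) (Icc t₁ t₂))
    (hane : ∀ t ∈ Icc t₁ t₂, a t ≠ 0) (hy : IsSolRiccati a b c d e (Ico t₁ t₂) y)
    (hm : ∀ t ∈ Ico t₁ t₂, m ≤ ∫ τ in t₁..t, a τ * y τ) :
    ∃ R, ∀ t ∈ Ico t₁ t₂, |y t| ≤ R ∧ |deriv y t| ≤ R := by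
  have hac : ContinuousOn a (Icc t₁ t₂) := fun t ht ↦ (had t ht).continuousAt.continuousWithinAt
  obtain ⟨Ca, hCa⟩ := isCompact_Icc.exists_bound_of_continuousOn hac
  obtain ⟨Cb, hCb⟩ := isCompact_Icc.exists_bound_of_continuousOn hbc
  obtain ⟨Cd, hCd⟩ := isCompact_Icc.exists_bound_of_continuousOn hdc
  obtain ⟨Ce, hCe⟩ := isCompact_Icc.exists_bound_of_continuousOn hec
  obtain ⟨Cg, hCg⟩ := isCompact_Icc.exists_bound_of_continuousOn
    ((hcc.sub ha').sub (hac.mul hbc))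
  obtain ⟨Cr, hCr⟩ := isCompact_Icc.exists_bound_of_continuousOn (hac.inv₀ hane)
  obtain ⟨Cs, hCs⟩ := isCompact_Icc.exists_bound_of_continuousOn
    (ha'.neg.div (hac.pow 2) fun t ht ↦ pow_ne_zero 2 (hane t ht))
  simp only [Real.norm_eq_abs] at hCa hCb hCd hCe hCg hCr hCs
  set K : ℝ := 1 + |Ca| + |Cb| + |Cd| + |Ce| + |Cg| + |Cr| + |Cs| with hK
  have hCK : ∀ C ∈ ({Ca, Cb, Cd, Ce, Cg, Cr, Cs} : Set ℝ), C ≤ K := by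
    intro C hC
    simp only [mem_insert_iff, mem_singleton_iff] at hC
    have := abs_nonneg Ca
    have := abs_nonneg Cb
    have := abs_nonneg Cd
    have := abs_nonneg Ce
    have := abs_nonneg Cg
    have := abs_nonneg Cr
    have := abs_nonneg Cs
    have := le_abs_self C
    rcases hC with rfl | rfl | rfl | rfl | rfl | rfl | rfl <;> linarith
  have hK1 : 1 ≤ K := by
    rw [hK]
    linarith [abs_nonneg Ca, abs_nonneg Cb, abs_nonneg Cd, abs_nonneg Ce, abs_nonneg Cg,
      abs_nonneg Cr, abs_nonneg Cs]
  have hI : ∀ t ∈ Ico t₁ t₂, t ∈ Icc t₁ t₂ := fun t ht ↦ Ico_subset_Icc_self ht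
  have hyd : ∀ t ∈ Ico t₁ t₂, HasDerivAt y (deriv y t) t := fun t ht ↦ (hy.1 t ht).hasDerivAt
  have hy'd : ∀ t ∈ Ico t₁ t₂, HasDerivAt (deriv y) (deriv (deriv y) t) t := fun t ht ↦
    (hy.2.1 t ht).hasDerivAt
  obtain ⟨F, hF, hFd⟩ := hasDerivAt_integral_of_continuousOn_Ico
    (g := fun τ ↦ a τ * y τ) (s := t₁) (t := t₂)
    ((hac.mono Ico_subset_Icc_self).mul
      fun t ht ↦ (hyd t ht).continuousAt.continuousWithinAt)
  set u : ℝ → ℝ := fun t ↦ Real.exp (F t)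
  set v : ℝ → ℝ := fun t ↦ u t * y t
  set w : ℝ → ℝ := fun t ↦ u t * (deriv y t + a t * y t ^ 2)
  have hupos : ∀ t, 0 < u t := fun t ↦ Real.exp_pos _
  have hud : ∀ t ∈ Ico t₁ t₂, HasDerivAt u (a t * v t) t := fun t ht ↦ by
    refine (hFd t ht).exp.congr_deriv ?_
    simp only [v, u]; ring
  have hvd : ∀ t ∈ Ico t₁ t₂, HasDerivAt v (w t) t := fun t ht ↦ by
    refine ((hud t ht).mul (hyd t ht)).congr_deriv ?_
    simp only [w, v]; ring
  have hwd : ∀ t ∈ Ico t₁ t₂, HasDerivAt w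
      (-(b t * w t) - (c t - deriv a t - a t * b t) * (v t ^ 2 / u t) - d t * v t - e t * u t) t :=
    fun t ht ↦ by
      refine ((hud t ht).mul ((hy'd t ht).add
        ((had t (hI t ht)).hasDerivAt.mul ((hyd t ht).pow 2)))).congr_deriv ?_
      have hvu : v t ^ 2 / u t = u t * y t ^ 2 := by
        simp only [v]
        field_simp [(hupos t).ne']
      rw [hvu]
      simp only [w, v, Pi.add_apply, Pi.mul_apply, Pi.pow_apply]
      linear_combination u t * hy.2.2 t ht
  obtain ⟨B, hB⟩ := exists_bound_of_quadratic_over_linear (r := fun t ↦ (a t)⁻¹)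
    (r' := fun t ↦ -deriv a t / a t ^ 2) h12 (Real.exp_pos m) hK1 hud hvd hwd
    (fun t ht ↦ (had t (hI t ht)).hasDerivAt.inv (hane t (hI t ht)))
    (fun t ht ↦ inv_mul_cancel₀ (hane t (hI t ht)))
    (fun t ht ↦ (hCa t (hI t ht)).trans (hCK _ (by simp)))
    (fun t ht ↦ (hCr t (hI t ht)).trans (hCK _ (by simp)))
    (fun t ht ↦ (hCs t (hI t ht)).trans (hCK _ (by simp)))
    (fun t ht ↦ Real.exp_le_exp.2 ((hm t ht).trans (hF t ht).ge))
    (fun t ht ↦ by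
      have q0 : 0 ≤ v t ^ 2 / u t := div_nonneg (sq_nonneg _) (hupos t).le
      have e1 : |b t * w t| ≤ K * |w t| := by
        rw [abs_mul]; gcongr; exact (hCb t (hI t ht)).trans (hCK _ (by simp))
      have e2 : |(c t - deriv a t - a t * b t) * (v t ^ 2 / u t)| ≤ K * (v t ^ 2 / u t) := by
        rw [abs_mul, abs_of_nonneg q0]; gcongr
        exact (hCg t (hI t ht)).trans (hCK _ (by simp))
      have e3 : |d t * v t| ≤ K * |v t| := by
        rw [abs_mul]; gcongr; exact (hCd t (hI t ht)).trans (hCK _ (by simp))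
      have e4 : |e t * u t| ≤ K * |u t| := by
        rw [abs_mul]; gcongr; exact (hCe t (hI t ht)).trans (hCK _ (by simp))
      rw [abs_le] at e1 e2 e3 e4 ⊢
      constructor <;> linarith)
  set ρ : ℝ := B / Real.exp m
  have hquot : ∀ t ∈ Ico t₁ t₂, ∀ x, |u t * x| ≤ B → |x| ≤ ρ := fun t ht x hx ↦ by
    rw [abs_mul, abs_of_pos (hupos t)] at hx
    rw [le_div_iff₀ (Real.exp_pos m)]
    have : Real.exp m ≤ u t := Real.exp_le_exp.2 ((hm t ht).trans (hF t ht).ge)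
    nlinarith [abs_nonneg x]
  have hyρ : ∀ t ∈ Ico t₁ t₂, |y t| ≤ ρ := fun t ht ↦ hquot t ht _ (by
    have := hB t ht
    linarith [abs_nonneg (u t), abs_nonneg (w t)])
  have hwρ : ∀ t ∈ Ico t₁ t₂, |deriv y t + a t * y t ^ 2| ≤ ρ := fun t ht ↦ hquot t ht _ (by
    have := hB t ht
    linarith [abs_nonneg (u t), abs_nonneg (v t)])
  refine ⟨ρ + K * ρ ^ 2, fun t ht ↦ ⟨(hyρ t ht).trans ?_, ?_⟩⟩
  · have : 0 ≤ K * ρ ^ 2 := by positivity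
    linarith
  · have h1 : |a t * y t ^ 2| ≤ K * ρ ^ 2 := by
      rw [abs_mul, abs_pow]
      have := hyρ t ht
      gcongr
      exact (hCa t (hI t ht)).trans (hCK _ (by simp))
    have h2 := hwρ t ht
    rw [abs_le] at h1 h2 ⊢
    constructor <;> linarith

/-- Lemma 2.2: if `a` is nonvanishing and a solution `y` of Eq. (1.1) on `[t1, t2)` has
`F(t) = ∫_{t1}^{t} a y` bounded from below, then `y` extends beyond `t2` as a solution. -/
theorem not_maximal_of_integral_bddBelow
    (t0 : ℝ) (a b c d e : ℝ → ℝ)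
    (hac : ContinuousOn a (Ici t0)) (hbc : ContinuousOn b (Ici t0))
    (hcc : ContinuousOn c (Ici t0)) (hdc : ContinuousOn d (Ici t0))
    (hec : ContinuousOn e (Ici t0))
    (hadiff : ∀ t ∈ Ici t0, DifferentiableAt ℝ a t) (ha' : ContinuousOn (deriv a) (Ici t0))
    (hbdiff : ∀ t ∈ Ici t0, DifferentiableAt ℝ b t) (hb' : ContinuousOn (deriv b) (Ici t0))
    (hane : ∀ t ∈ Ici t0, a t ≠ 0)
    (t1 t2 : ℝ) (ht01 : t0 ≤ t1) (ht12 : t1 < t2)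
    (y : ℝ → ℝ) (hy : IsSolRiccati a b c d e (Ico t1 t2) y)
    (m : ℝ) (hm : ∀ t ∈ Ico t1 t2, m ≤ ∫ τ in t1..t, a τ * y τ) :
    ∃ t3 > t2, ∃ ytilde : ℝ → ℝ,
      IsSolRiccati a b c d e (Ico t1 t3) ytilde ∧
      ∀ t ∈ Ico t1 t2, ytilde t = y t := by
  have hsub : ∀ T, Icc t1 T ⊆ Ici t0 := fun T t ht ↦ ht01.trans ht.1
  obtain ⟨R, hR⟩ := hy.exists_bound ht12 (hbc.mono (hsub t2)) (hcc.mono (hsub t2))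
    (hdc.mono (hsub t2)) (hec.mono (hsub t2)) (fun t ht ↦ hadiff t (hsub t2 ht))
    (ha'.mono (hsub t2)) (fun t ht ↦ hane t (hsub t2 ht)) hm
  have hT := hsub (t2 + 1)
  exact hy.exists_extension ht12 (lt_add_one t2) (hac.mono hT) (hbc.mono hT) (hcc.mono hT)
    (hdc.mono hT) (hec.mono hT) hR
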